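/- Let δ, c ∈ ℝ and let J ⊆ (0,∞) be an open interval on which c·y⁴ − δ > 0. Define g(y) := −δ/(y³·√(c·y⁴ − δ)) and h(y) := −δ/y⁵ on J. Then the function y ↦ √(c·y⁴ − δ)/y² (which equals h(y)/g(y)) is differentiable on J with derivative equal to −2·g(y); that is, the pair (g, h) satisfies the Chiellini integrability condition with p = −2. -/

import Mathlib

open Set

/-- On an open interval `J ⊆ (0,∞)` where `c·y⁴ − δ > 0`, with
`g(y) = −δ/(y³·√(c·y⁴ − δ))` and `h(y) = −δ/y⁵`, the function `y ↦ √(c·y⁴ − δ)/y²`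
(which equals `h/g`) is differentiable with derivative `−2·g(y)`: the pair `(g, h)`
satisfies the Chiellini condition with `p = −2`. -/
theorem chiellini_quintic_milne_pinney (dlt c aJ bJ : ℝ) (g h : ℝ → ℝ)
    (hJpos : ∀ y ∈ Ioo aJ bJ, 0 < y)
    (hJ : ∀ y ∈ Ioo aJ bJ, 0 < c * y ^ 4 - dlt)
    (hgdef : ∀ y ∈ Ioo aJ bJ, g y = -dlt / (y ^ 3 * Real.sqrt (c * y ^ 4 - dlt)))
    (hhdef : ∀ y ∈ Ioo aJ bJ, h y = -dlt / y ^ 5) :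
    ∀ y ∈ Ioo aJ bJ,
      HasDerivAt (fun u => Real.sqrt (c * u ^ 4 - dlt) / u ^ 2) (-2 * g y) y := by
  intro y hy
  have hy0 : y ≠ 0 := (hJpos y hy).ne'
  have hrad := hJ y hy
  have hsqrt : √(c * y ^ 4 - dlt) ≠ 0 := (Real.sqrt_pos.2 hrad).ne'
  have hpoly : HasDerivAt (fun u => c * u ^ 4 - dlt) (c * (4 * y ^ 3)) y := by
    simpa using ((hasDerivAt_pow 4 y).const_mul c).sub_const dlt
  have hquot := (hpoly.sqrt hrad.ne').fun_div (hasDerivAt_pow 2 y) (pow_ne_zero 2 hy0)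
  refine hquot.congr_deriv ?_
  rw [hgdef y hy]
  field_simp
  rw [Real.sq_sqrt hrad.le]
  push_cast
  ring
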